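/- non(M) equals the least cardinality of a family F ⊆ ω^ω such that for every g ∈ ω^ω there exists f ∈ F with f(n) = g(n) for infinitely many n. -/

import Mathlib

open Cardinal

/-- `non(M)`: the least cardinality of a non-meager subset of Baire space `ω^ω`. -/
noncomputable def nonMeager : Cardinal :=
  sInf {c | ∃ A : Set (ℕ → ℕ), ¬ IsMeagre A ∧ #A = c}

/-- A family of functions such that every function agrees infinitely often with some member. -/
def IsInfinitelyOftenEqual (F : Set (ℕ → ℕ)) : Prop :=
  ∀ g : ℕ → ℕ, ∃ f ∈ F, {n : ℕ | f n = g n}.Infinite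

theorem isInfinitelyOftenEqual_of_not_isMeagre {A : Set (ℕ → ℕ)} (hA : ¬ IsMeagre A) :
    IsInfinitelyOftenEqual A := by
  intro g
  by_contra! hg
  apply hA
  have hcl : ∀ n, IsClosed {f : ℕ → ℕ | ∀ m, n ≤ m → f m ≠ g m} := by
    intro n
    simp only [Set.ofPred_forall]
    refine isClosed_iInter fun m => isClosed_iInter fun _ => ?_
    exact (isClosed_discrete ({g m}ᶜ : Set ℕ)).preimage (continuous_apply (A := fun _ : ℕ => ℕ) m)
  refine IsMeagre.mono (t := A) (s := ⋃ n, {f : ℕ → ℕ | ∀ m, n ≤ m → f m ≠ g m}) ?_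
    (isMeagre_iUnion fun n => IsNowhereDense.isMeagre ?_)
  · intro f hf
    obtain ⟨N, hN⟩ := (hg f hf).bddAbove
    refine Set.mem_iUnion.2 ⟨N + 1, fun m hm h => ?_⟩
    have := hN (show m ∈ {n | f n = g n} from h)
    omega
  · rw [IsNowhereDense, (hcl n).closure_eq, Set.eq_empty_iff_forall_notMem]
    intro x hx
    obtain ⟨_, ⟨y, k, rfl⟩, hxy, hsub⟩ :=
      (PiNat.isTopologicalBasis_cylinders fun _ : ℕ => ℕ).exists_subset_of_mem_open hx
        isOpen_interior
    have hz : (fun i => if i < k then y i else g i) ∈ PiNat.cylinder y k := by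
      intro i hi
      simp [hi]
    exact interior_subset (hsub hz) (max n k) (le_max_left _ _) (by simp)

theorem IsInfinitelyOftenEqual.infinite {F : Set (ℕ → ℕ)} (hF : IsInfinitelyOftenEqual F) :
    F.Infinite := by
  intro hfin
  obtain ⟨f, hf, hinf⟩ := hF fun n => ∑ f ∈ hfin.toFinset, f n + 1
  obtain ⟨n, hn⟩ := hinf.nonempty
  have : f n ≤ ∑ f ∈ hfin.toFinset, f n :=
    Finset.single_le_sum (f := fun f : ℕ → ℕ => f n) (fun _ _ => Nat.zero_le _)
      (hfin.mem_toFinset.2 hf)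
  simp only [Set.mem_ofPred_eq] at hn
  omega

/-- A single block of values can force membership in finitely many dense open sets, for finitely
many initial segments of length `m` simultaneously. -/
theorem exists_block_of_finset {D : ℕ → Set (ℕ → ℕ)} (ho : ∀ k, IsOpen (D k))
    (hd : ∀ k, Dense (D k)) (m : ℕ) (S : Finset (ℕ × (ℕ → ℕ))) :
    ∃ (τ : ℕ → ℕ) (b : ℕ), ∀ s ∈ S, ∀ x : ℕ → ℕ, (∀ i < m, x i = s.2 i) →
      (∀ i, m ≤ i → i < b → x i = τ i) → x ∈ D s.1 := by
  classical
  induction S using Finset.induction_on with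
  | empty => exact ⟨0, 0, by simp⟩
  | insert s S _ ih =>
    obtain ⟨τ, b, h⟩ := ih
    obtain ⟨z, hz, hzD⟩ := (hd s.1).inter_open_nonempty _
      (PiNat.isOpen_cylinder (fun _ : ℕ => ℕ) (fun i => if i < m then s.2 i else τ i) (max m b))
      ⟨_, PiNat.self_mem_cylinder _ _⟩
    obtain ⟨_, ⟨y, k, rfl⟩, hzy, hsub⟩ :=
      (PiNat.isTopologicalBasis_cylinders fun _ : ℕ => ℕ).exists_subset_of_mem_open hzD (ho s.1)
    refine ⟨z, max b k, fun t ht x hx hx' => ?_⟩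
    rcases Finset.mem_insert.1 ht with rfl | ht
    · refine hsub fun i hi => ?_
      rw [← hzy i hi]
      rcases lt_or_ge i m with him | him
      · rw [hx i him, hz i (lt_max_of_lt_left him)]
        exact (if_pos him).symm
      · exact hx' i him (lt_max_of_lt_right hi)
    · refine h t ht x hx fun i him hib => ?_
      rw [hx' i him (lt_max_of_lt_left hib), hz i (lt_max_of_lt_right hib)]
      exact if_neg him.not_gt

theorem exists_block {D : ℕ → Set (ℕ → ℕ)} (ho : ∀ k, IsOpen (D k))
    (hd : ∀ k, Dense (D k)) (m : ℕ) :
    ∃ l : List ℕ, ∀ k < m, ∀ x : ℕ → ℕ, (∀ i < m, x i < m) →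
      (∀ i, m ≤ i → i < l.length → x i = l.getD i 0) → x ∈ D k := by
  classical
  obtain ⟨τ, b, h⟩ := exists_block_of_finset ho hd m
    (Finset.range m ×ˢ (Finset.univ : Finset (Fin m → Fin m)).image
      fun s i => if hi : i < m then (s ⟨i, hi⟩ : ℕ) else 0)
  refine ⟨(List.range b).map τ, fun k hk x hx hx' => ?_⟩
  refine h (k, fun i => if i < m then x i else 0) ?_ x (fun i hi => by simp [hi]) fun i him hib => ?_
  · refine Finset.mem_product.2 ⟨Finset.mem_range.2 hk, Finset.mem_image.2 ?_⟩
    refine ⟨fun i => ⟨x i, hx i i.2⟩, Finset.mem_univ _, ?_⟩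
    funext i
    simp
  · rw [hx' i him (by simpa using hib)]
    simp [hib]

/-- Right endpoints of consecutive intervals of lengths `f 0 + 1`, `f 1 + 1`, …. -/
def partialSum (f : ℕ → ℕ) (n : ℕ) : ℕ := ∑ i ∈ Finset.range n, (f i + 1)

theorem partialSum_succ (f : ℕ → ℕ) (n : ℕ) : partialSum f (n + 1) = partialSum f n + (f n + 1) :=
  Finset.sum_range_succ _ _

theorem partialSum_strictMono (f : ℕ → ℕ) : StrictMono (partialSum f) :=
  strictMono_nat_of_lt_succ fun n => by rw [partialSum_succ]; omega

theorem IsInfinitelyOftenEqual.exists_partialSum {F : Set (ℕ → ℕ)}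
    (hF : IsInfinitelyOftenEqual F) (b : ℕ → ℕ) :
    ∃ f ∈ F, {n | b (partialSum f n) ≤ partialSum f (n + 1)}.Infinite := by
  set q := partialSum b with hq
  have hb : ∀ m, b m < q (m + 1) := fun m => by rw [hq, partialSum_succ]; omega
  have hmono : StrictMono fun m => q (m + 1) :=
    fun _ _ h => partialSum_strictMono b (Nat.succ_lt_succ h)
  set r : ℕ → ℕ := fun n => (fun m => q (m + 1))^[n] 0 with hr
  have hr_succ : ∀ n, r (n + 1) = q (r n + 1) := fun n => Function.iterate_succ_apply' _ _ _
  have hr_mono : StrictMono r := strictMono_nat_of_lt_succ fun n => by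
    rw [hr_succ]
    exact (partialSum_strictMono b).le_apply
  obtain ⟨f, hf, hinf⟩ := hF fun n => r (2 * n + 2)
  refine ⟨f, hf, fun hfin => ?_⟩
  obtain ⟨N, hN⟩ := hfin.bddAbove
  set p := partialSum f with hp
  have hlt : ∀ n, N < n → p (n + 1) < b (p n) := fun n hn => by
    by_contra! h
    exact hn.not_ge (hN h)
  have hle : ∀ j, p (N + 1 + j) ≤ r (p (N + 1) + j) := fun j => by
    induction j with
    | zero => exact hr_mono.le_apply
    | succ j ih =>
      calc p (N + 1 + j + 1) ≤ b (p (N + 1 + j)) := (hlt _ (by omega)).le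
        _ ≤ q (p (N + 1 + j) + 1) := (hb _).le
        _ ≤ q (r (p (N + 1) + j) + 1) := hmono.monotone ih
        _ = _ := (hr_succ _).symm
  obtain ⟨n, hn, hnN⟩ := hinf.exists_gt (N + p (N + 1))
  have h1 := hle (n - N)
  rw [show N + 1 + (n - N) = n + 1 by omega, hp, partialSum_succ, ← hp] at h1
  have h2 := hr_mono.monotone (show p (N + 1) + (n - N) ≤ 2 * n + 2 by omega)
  have h3 : f n = r (2 * n + 2) := hn
  omega

theorem exists_injective_selection (L : ℕ → Finset ℕ) :
    ∃ c : ℕ → ℕ, c.Injective ∧ ∀ k, k < (L k).card → c k ∈ L k := by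
  obtain ⟨c, hc, hcL⟩ := (Finset.all_card_le_biUnion_card_iff_exists_injective
    fun k => if k < (L k).card then L k else Finset.range (k + 1)).1 fun s => by
      rcases s.eq_empty_or_nonempty with rfl | hs
      · simp
      · have hsub : s ⊆ Finset.range (s.max' hs + 1) := fun k hk =>
          Finset.mem_range.2 (Nat.lt_succ_of_le (s.le_max' k hk))
        refine (Finset.card_le_card hsub).trans (le_trans ?_
          (Finset.card_le_card (Finset.subset_biUnion_of_mem _ (s.max'_mem hs))))
        split_ifs with h
        · simpa using h
        · exact le_rfl
  refine ⟨c, hc, fun k hk => ?_⟩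
  simpa [hk] using hcL k

/-- Functions to a countable type can be guessed infinitely often on any prescribed infinite set of
arguments. -/
theorem exists_guess_on_infinite (β : Type) [Encodable β] [Nonempty β] :
    ∃ Φ : (ℕ → ℕ) → ℕ → β, ∀ F, IsInfinitelyOftenEqual F → ∀ A : Set ℕ, A.Infinite →
      ∀ g : ℕ → β, ∃ h ∈ F, {n | n ∈ A ∧ Φ h n = g n}.Infinite := by
  classical
  have key : ∀ h : ℕ → ℕ, ∃ φ : ℕ → β, ∀ A : Set ℕ, ∀ g : ℕ → β,
      {k | ∃ s : Finset ℕ, ↑s ⊆ A ∧ k < s.card ∧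
        h k = Encodable.encode (s.image fun n => (n, g n))}.Infinite →
      {n | n ∈ A ∧ φ n = g n}.Infinite := by
    intro h
    set T : ℕ → Finset (ℕ × β) := fun k => (Encodable.decode (h k)).getD ∅ with hT
    obtain ⟨c, hc, hcT⟩ := exists_injective_selection fun k => (T k).image Prod.fst
    have hφ : ∀ n, ∃ v : β, ∀ k, c k = n → ∀ w, T k = w → n ∈ w.image Prod.fst → (n, v) ∈ w := by
      intro n
      by_cases hn : ∃ k, c k = n ∧ n ∈ (T k).image Prod.fst
      · obtain ⟨k, hk, hkn⟩ := hn
        obtain ⟨⟨a, v⟩, hv, rfl⟩ := Finset.mem_image.1 hkn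
        refine ⟨v, fun k' hk' w hw _ => ?_⟩
        rw [← hw, hc (hk'.trans hk.symm)]
        exact hv
      · refine ⟨Classical.arbitrary β, fun k hk w hw hkn => (hn ⟨k, hk, hw ▸ hkn⟩).elim⟩
    choose φ hφ using hφ
    refine ⟨φ, fun A g hinf => (hinf.image hc.injOn).mono ?_⟩
    rintro _ ⟨k, ⟨s, hsA, hks, hk⟩, rfl⟩
    have hTk : T k = s.image fun n => (n, g n) := by simp [hT, hk]
    have himg : (T k).image Prod.fst = s := by
      rw [hTk, Finset.image_image]
      exact Finset.image_id
    have hck := hcT k (by rwa [himg])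
    have hmem := hφ (c k) k rfl _ rfl hck
    rw [himg] at hck
    rw [hTk] at hmem
    obtain ⟨a, _, ha⟩ := Finset.mem_image.1 hmem
    obtain ⟨ha1, ha2⟩ := Prod.mk.inj ha
    exact ⟨hsA hck, by rw [← ha2, ha1]⟩
  choose Φ hΦ using key
  refine ⟨Φ, fun F hF A hA g => ?_⟩
  choose s hsA hs using fun k : ℕ => hA.exists_subset_card_eq (k + 1)
  obtain ⟨h, hh, hinf⟩ := hF fun k => Encodable.encode ((s k).image fun n => (n, g n))
  refine ⟨h, hh, hΦ h A g (hinf.mono fun k hk => ⟨s k, hsA k, ?_, hk⟩)⟩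
  rw [hs]
  omega

/-- The function which on the `n`-th interval determined by `f` copies the list `l n`, with values
outside the bound `partialSum f (n + 1)` replaced by zero. -/
theorem exists_glue (f : ℕ → ℕ) (l : ℕ → List ℕ) :
    ∃ x : ℕ → ℕ, (∀ n, ∀ i < partialSum f n, x i < partialSum f n) ∧
      ∀ n i, partialSum f n ≤ i → i < partialSum f (n + 1) →
        (l n).getD i 0 < partialSum f (n + 1) → x i = (l n).getD i 0 := by
  have hmono := partialSum_strictMono f
  have hex : ∀ i, ∃ n, i < partialSum f (n + 1) := fun i =>
    ⟨i, (Nat.lt_succ_self i).trans_le hmono.le_apply⟩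
  refine ⟨fun i => if (l (Nat.find (hex i))).getD i 0 < partialSum f (Nat.find (hex i) + 1) then
    (l (Nat.find (hex i))).getD i 0 else 0, fun n i hi => ?_, fun n i hni hin hl => ?_⟩
  · obtain _ | n := n
    · simp [partialSum] at hi
    · have hle : partialSum f (Nat.find (hex i) + 1) ≤ partialSum f (n + 1) :=
        hmono.monotone (Nat.succ_le_succ (Nat.find_min' _ hi))
      dsimp only
      split_ifs with h
      · exact h.trans_le hle
      · omega
  · have hfind : Nat.find (hex i) = n := by
      refine (Nat.find_eq_iff _).2 ⟨hin, fun k hk hik => ?_⟩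
      exact (hmono.monotone (Nat.succ_le_of_lt hk)).not_gt (hni.trans_lt hik)
    dsimp only
    rw [hfind, if_pos hl]

theorem IsInfinitelyOftenEqual.exists_not_isMeagre {F : Set (ℕ → ℕ)}
    (hF : IsInfinitelyOftenEqual F) : ∃ A : Set (ℕ → ℕ), ¬ IsMeagre A ∧ #A ≤ #F := by
  obtain ⟨Φ, hΦ⟩ := exists_guess_on_infinite (List ℕ)
  choose X hX_lt hX using fun f h => exists_glue f (Φ h)
  refine ⟨Set.range fun a : F × F => X a.1 a.2, fun hM => ?_, ?_⟩
  · obtain ⟨S, hSo, hSd, hSc, hS⟩ := mem_residual_iff.1 hM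
    obtain ⟨D, hD⟩ := (hSc.insert Set.univ).exists_eq_range (Set.insert_nonempty _ _)
    have hDS : ∀ k, D k = Set.univ ∨ D k ∈ S := fun k => by
      rw [← Set.mem_insert_iff, hD]
      exact Set.mem_range_self k
    have ho : ∀ k, IsOpen (D k) := fun k => by
      rcases hDS k with h | h
      · rw [h]; exact isOpen_univ
      · exact hSo _ h
    have hd : ∀ k, Dense (D k) := fun k => by
      rcases hDS k with h | h
      · rw [h]; exact dense_univ
      · exact hSd _ h
    choose l hl using exists_block ho hd
    obtain ⟨f, hf, hinf⟩ := hF.exists_partialSum fun m => (l m).length + (l m).sum + 1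
    obtain ⟨h, hh, hinf⟩ := hΦ F hF _ hinf fun n => l (partialSum f n)
    refine hS (a := X f h) (fun t ht => ?_) ⟨(⟨f, hf⟩, ⟨h, hh⟩), rfl⟩
    obtain ⟨k, rfl⟩ : t ∈ Set.range D := hD ▸ Set.mem_insert_of_mem _ ht
    obtain ⟨n, ⟨hn, hnΦ⟩, hkn⟩ := hinf.exists_gt k
    rw [Set.mem_ofPred_eq] at hn
    refine hl (partialSum f n) k (hkn.trans_le (partialSum_strictMono f).le_apply) _
      (hX_lt f h n) fun i hni hil => ?_
    rw [hX f h n i hni (by omega), hnΦ]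
    rw [hnΦ, List.getD_eq_getElem _ _ hil]
    have := List.single_le_sum (l := l (partialSum f n)) (fun _ _ => Nat.zero_le _) _
      (List.getElem_mem hil)
    omega
  · have hinf : ℵ₀ ≤ #F := Cardinal.infinite_iff.1 hF.infinite.to_subtype
    calc #(Set.range fun a : F × F => X a.1 a.2) ≤ #(F × F) := mk_range_le
      _ = #F := by rw [mk_prod, lift_id, mul_eq_self hinf]

/-- `non(M)` equals the least cardinality of a family `F ⊆ ω^ω` such that every
`g ∈ ω^ω` agrees infinitely often with some member of `F`. -/
theorem nonMeager_eq_min_infinitelyOftenEqual_family :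
    nonMeager = sInf {c | ∃ F : Set (ℕ → ℕ), #F = c ∧
      ∀ g : ℕ → ℕ, ∃ f ∈ F, {n : ℕ | f n = g n}.Infinite} := by
  have huniv : ¬ IsMeagre (Set.univ : Set (ℕ → ℕ)) :=
    not_isMeagre_of_isOpen isOpen_univ Set.univ_nonempty
  refine le_antisymm (le_csInf ?_ ?_) (le_csInf ?_ ?_)
  · exact ⟨_, Set.univ, rfl, isInfinitelyOftenEqual_of_not_isMeagre huniv⟩
  · rintro _ ⟨F, rfl, hF⟩
    obtain ⟨A, hA, hAF⟩ := IsInfinitelyOftenEqual.exists_not_isMeagre hF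
    exact le_trans (csInf_le' ⟨A, hA, rfl⟩) hAF
  · exact ⟨_, Set.univ, huniv, rfl⟩
  · rintro _ ⟨A, hA, rfl⟩
    exact csInf_le' ⟨A, rfl, isInfinitelyOftenEqual_of_not_isMeagre hA⟩
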